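/- arXiv:1505.07217 — 2 statements merged into one kernel-verified Lean document; each statement's English description precedes it below -/
import Mathlib

section
/- For every integer n ≥ 3 and every real c > 0, let x₁ = (n·√(n−1) − 2n + 2)·c. Then α'(x₁) = 0, α''(x₁) = 2/((n−2)²·√(n−1)·c), α(x₁) = 2·√(n−1)·c, and α(x) ≥ 2·√(n−1)·c for all x ≥ 0. -/
open Real Filter

noncomputable def alphaF (n : ℕ) (c : ℝ) (x : ℝ) : ℝ :=
  (n : ℝ) * c + ((n : ℝ) / (2 * ((n : ℝ) - 1))) * x
    - (((n : ℝ) - 2) / (2 * ((n : ℝ) - 1))) * Real.sqrt (x ^ 2 + 4 * ((n : ℝ) - 1) * c * x)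

noncomputable def yn (n : ℕ) : ℝ :=
  4 * (1 - (n : ℝ)) + (2 * ((n : ℝ) ^ 2 - 4) / Real.sqrt (2 * (n : ℝ) - 5)) *
    Real.cos ((1 / 3) * Real.arctan (((n : ℝ) ^ 2 - 4 * (n : ℝ) + 6) /
      (2 * ((n : ℝ) - 1) * Real.sqrt (2 * (n : ℝ) - 5))))

noncomputable def x0 (n : ℕ) (c : ℝ) : ℝ := yn n * c

noncomputable def betaF (n : ℕ) (c : ℝ) (x : ℝ) : ℝ :=
  alphaF n c (x0 n c) + deriv (alphaF n c) (x0 n c) * (x - x0 n c)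
    + (1 / 2) * deriv (deriv (alphaF n c)) (x0 n c) * (x - x0 n c) ^ 2

noncomputable def gammaF (n : ℕ) (c : ℝ) (x : ℝ) : ℝ :=
  if x0 n c ≤ x then alphaF n c x else betaF n c x

noncomputable def gammaF' (n : ℕ) (c : ℝ) (x : ℝ) : ℝ :=
  derivWithin (gammaF n c) (Set.Ici 0) x

noncomputable def gammaF'' (n : ℕ) (c : ℝ) (x : ℝ) : ℝ :=
  derivWithin (gammaF' n c) (Set.Ici 0) x

noncomputable def omegaF (n : ℕ) (c : ℝ) (x : ℝ) : ℝ :=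
  (x ^ 2 / Real.sqrt (x ^ 2 + 4 * ((n : ℝ) - 1) * c * x)) *
    ((1 + (n : ℝ) ^ 2 * c / x) *
      (((n : ℝ) / ((n : ℝ) - 2) - (1 + 4 * ((n : ℝ) - 1) * c / x) ^ (-(1 / 2) : ℝ)) /
       ((n : ℝ) / ((n : ℝ) - 2) + (1 + 4 * ((n : ℝ) - 1) * c / x) ^ (-(1 / 2) : ℝ)))) ^ 2

theorem hasDerivAt_sq_add_const_mul (k x : ℝ) :
    HasDerivAt (fun y : ℝ => y ^ 2 + k * y) (2 * x + k) x := by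
  simpa using (hasDerivAt_pow 2 x).fun_add ((hasDerivAt_id x).const_mul k)

/-- The first derivative of `alphaF n c` at a positive point. -/
theorem hasDerivAt_alphaF {n : ℕ} (hn : 3 ≤ n) {c : ℝ} (hc : 0 < c) {x : ℝ} (hx : 0 < x) :
    HasDerivAt (alphaF n c)
      ((n : ℝ) / (2 * ((n : ℝ) - 1)) - (((n : ℝ) - 2) / (2 * ((n : ℝ) - 1))) *
        ((x + 2 * ((n : ℝ) - 1) * c) / √(x ^ 2 + 4 * ((n : ℝ) - 1) * c * x))) x := by
  have hn' : (3 : ℝ) ≤ n := by exact_mod_cast hn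
  have hm : 0 < (n : ℝ) - 1 := by linarith
  have hQ : 0 < x ^ 2 + 4 * ((n : ℝ) - 1) * c * x := by positivity
  have hpoly := hasDerivAt_sq_add_const_mul (4 * ((n : ℝ) - 1) * c) x
  have h := (((hasDerivAt_id x).const_mul ((n : ℝ) / (2 * ((n : ℝ) - 1)))).const_add
    ((n : ℝ) * c)).sub
      ((hpoly.sqrt hQ.ne').const_mul (((n : ℝ) - 2) / (2 * ((n : ℝ) - 1))))
  refine h.congr_deriv ?_
  have := (Real.sqrt_pos.2 hQ).ne'
  field_simp
  ring

/-- The second derivative of `alphaF n c` at a positive point. -/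
theorem deriv_deriv_alphaF {n : ℕ} (hn : 3 ≤ n) {c : ℝ} (hc : 0 < c) {x : ℝ} (hx : 0 < x) :
    deriv (deriv (alphaF n c)) x =
      2 * ((n : ℝ) - 2) * ((n : ℝ) - 1) * c ^ 2 /
        √(x ^ 2 + 4 * ((n : ℝ) - 1) * c * x) ^ 3 := by
  have hn' : (3 : ℝ) ≤ n := by exact_mod_cast hn
  have hm : 0 < (n : ℝ) - 1 := by linarith
  have hQ : 0 < x ^ 2 + 4 * ((n : ℝ) - 1) * c * x := by positivity
  have hderiv : deriv (alphaF n c) =ᶠ[nhds x] fun y =>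
      (n : ℝ) / (2 * ((n : ℝ) - 1)) - (((n : ℝ) - 2) / (2 * ((n : ℝ) - 1))) *
        ((y + 2 * ((n : ℝ) - 1) * c) / √(y ^ 2 + 4 * ((n : ℝ) - 1) * c * y)) := by
    filter_upwards [lt_mem_nhds hx] with y hy using (hasDerivAt_alphaF hn hc hy).deriv
  rw [hderiv.deriv_eq]
  have hpoly := hasDerivAt_sq_add_const_mul (4 * ((n : ℝ) - 1) * c) x
  have hsqrt := Real.sqrt_pos.2 hQ
  have h := ((((hasDerivAt_id x).add_const (2 * ((n : ℝ) - 1) * c)).div (hpoly.sqrt hQ.ne')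
    hsqrt.ne').const_mul (((n : ℝ) - 2) / (2 * ((n : ℝ) - 1)))).const_sub
      ((n : ℝ) / (2 * ((n : ℝ) - 1)))
  refine h.deriv.trans ?_
  have hsq := Real.sq_sqrt hQ.le
  simp only [id]
  generalize √(x ^ 2 + 4 * ((n : ℝ) - 1) * c * x) = r at hsq hsqrt
  field_simp
  rw [hsq]
  ring

theorem stmt_16 (n : ℕ) (hn : 3 ≤ n) (c : ℝ) (hc : 0 < c) :
    deriv (alphaF n c) (((n : ℝ) * Real.sqrt ((n : ℝ) - 1) - 2 * (n : ℝ) + 2) * c) = 0 ∧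
    deriv (deriv (alphaF n c)) (((n : ℝ) * Real.sqrt ((n : ℝ) - 1) - 2 * (n : ℝ) + 2) * c) =
      2 / (((n : ℝ) - 2) ^ 2 * Real.sqrt ((n : ℝ) - 1) * c) ∧
    alphaF n c (((n : ℝ) * Real.sqrt ((n : ℝ) - 1) - 2 * (n : ℝ) + 2) * c) =
      2 * Real.sqrt ((n : ℝ) - 1) * c ∧
    ∀ x : ℝ, 0 ≤ x → alphaF n c x ≥ 2 * Real.sqrt ((n : ℝ) - 1) * c := by
  have hn' : (3 : ℝ) ≤ n := by exact_mod_cast hn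
  have hs2 : √((n : ℝ) - 1) ^ 2 = (n : ℝ) - 1 := Real.sq_sqrt (by linarith)
  have hs0 : 0 ≤ √((n : ℝ) - 1) := Real.sqrt_nonneg _
  generalize √((n : ℝ) - 1) = s at hs2 hs0 ⊢
  have hs1 : 1 < s := by nlinarith
  have hn_eq : (n : ℝ) = s ^ 2 + 1 := by linarith
  have hd : 0 < s ^ 2 - 1 := by nlinarith
  have hx_eq : ((n : ℝ) * s - 2 * (n : ℝ) + 2) * c = s * (s - 1) ^ 2 * c := by
    rw [hn_eq]; ring
  have hx : 0 < s * (s - 1) ^ 2 * c := by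
    have : 0 < s - 1 := by linarith
    positivity
  have hsqrt : √((s * (s - 1) ^ 2 * c) ^ 2 + 4 * ((n : ℝ) - 1) * c * (s * (s - 1) ^ 2 * c)) =
      s * (s ^ 2 - 1) * c := by
    rw [← Real.sqrt_sq (by positivity : 0 ≤ s * (s ^ 2 - 1) * c), hn_eq]
    congr 1
    ring
  rw [hx_eq]
  refine ⟨?_, ?_, ?_, fun x hx0 => ?_⟩
  · rw [(hasDerivAt_alphaF hn hc hx).deriv, hsqrt, hn_eq, add_sub_cancel_right,
      show s ^ 2 + 1 - 2 = s ^ 2 - 1 by ring]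
    field_simp
    ring
  · rw [deriv_deriv_alphaF hn hc hx, hsqrt, hn_eq, add_sub_cancel_right,
      show s ^ 2 + 1 - 2 = s ^ 2 - 1 by ring]
    field_simp
  · rw [alphaF, hsqrt, hn_eq, add_sub_cancel_right]
    field_simp
    ring
  · have hbound : (s ^ 2 - 1) * √(x ^ 2 + 4 * s ^ 2 * c * x) ≤
        2 * s ^ 2 * (s - 1) ^ 2 * c + (s ^ 2 + 1) * x := by
      have hQ : 0 ≤ x ^ 2 + 4 * s ^ 2 * c * x := by positivity
      refine abs_le_of_sq_le_sq' ?_ (by positivity) |>.2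
      rw [mul_pow, Real.sq_sqrt hQ]
      linarith [sq_nonneg (2 * s * (x - s * (s - 1) ^ 2 * c))]
    have hdiff : alphaF n c x - 2 * s * c =
        (2 * s ^ 2 * (s - 1) ^ 2 * c + (s ^ 2 + 1) * x -
          (s ^ 2 - 1) * √(x ^ 2 + 4 * s ^ 2 * c * x)) / (2 * s ^ 2) := by
      rw [alphaF, hn_eq, add_sub_cancel_right]
      field_simp
      ring
    have := div_nonneg (sub_nonneg.2 hbound) (by positivity : 0 ≤ 2 * s ^ 2)
    linarith
end

section
/- For every integer n ≥ 3, every real c > 0 and every x ≥ 0, the identity ((n−2)/√(n(n−1)))·√(x·(α(x) − x/n)) + α(x) = (2/n)·x + n·c holds. -/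
open Real Filter

theorem stmt_18 (n : ℕ) (hn : 3 ≤ n) (c : ℝ) (hc : 0 < c) (x : ℝ) (hx : 0 ≤ x) :
    (((n : ℝ) - 2) / Real.sqrt ((n : ℝ) * ((n : ℝ) - 1))) *
        Real.sqrt (x * (alphaF n c x - x / (n : ℝ))) + alphaF n c x =
      (2 / (n : ℝ)) * x + (n : ℝ) * c := by
  have hn3 : (3 : ℝ) ≤ n := by exact_mod_cast hn
  have hn0 : (0 : ℝ) < n := by linarith
  have hn1 : (0 : ℝ) < (n : ℝ) - 1 := by linarith
  have hrad : 0 ≤ 4 * ((n : ℝ) - 1) * c * x := by positivity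
  have hSx : x ≤ √(x ^ 2 + 4 * ((n : ℝ) - 1) * c * x) := Real.le_sqrt_of_sq_le (by linarith)
  have hS2 := Real.sq_sqrt (add_nonneg (sq_nonneg x) hrad)
  unfold alphaF
  set S := √(x ^ 2 + 4 * ((n : ℝ) - 1) * c * x)
  have hR : 0 < √((n : ℝ) * ((n : ℝ) - 1)) := Real.sqrt_pos.2 (mul_pos hn0 hn1)
  have hR2 := Real.sq_sqrt (mul_pos hn0 hn1).le
  set R := √((n : ℝ) * ((n : ℝ) - 1))
  have hsqrt : √(x * ((n : ℝ) * c + ((n : ℝ) / (2 * ((n : ℝ) - 1))) * x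
      - (((n : ℝ) - 2) / (2 * ((n : ℝ) - 1))) * S - x / (n : ℝ))) =
      (n * S - (n - 2) * x) / (2 * R) := by
    rw [show x * ((n : ℝ) * c + ((n : ℝ) / (2 * ((n : ℝ) - 1))) * x
        - (((n : ℝ) - 2) / (2 * ((n : ℝ) - 1))) * S - x / (n : ℝ)) =
        ((n * S - (n - 2) * x) / (2 * R)) ^ 2 from ?_]
    · refine Real.sqrt_sq (div_nonneg ?_ (by positivity))
      nlinarith
    · rw [div_pow, mul_pow, hR2]
      field_simp
      linear_combination -(n : ℝ) ^ 2 * hS2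
  rw [hsqrt, show ((n : ℝ) - 2) / R * ((n * S - (n - 2) * x) / (2 * R)) =
    (n - 2) * (n * S - (n - 2) * x) / (2 * R ^ 2) by field_simp, hR2]
  field_simp
  ring
end
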